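/- arXiv:2604.08013 — 2 statements merged into one kernel-verified Lean document; each statement's English description precedes it below -/
import Mathlib

section
/- There exist a real number δ₊ > 0 and an infinite set M₊ ⊆ ℕ such that for every m ∈ M₊ one has dist(α(m+3/4)², ℤ) ≥ δ₊. -/
noncomputable def G : ℝ := ∑' n : ℕ, Real.sin (((n : ℝ) + 1) * Real.pi / 3) / ((n : ℝ) + 1) ^ 2

noncomputable def alpha : ℝ := 4 * Real.pi ^ 2 / G

/-- The distance from a real number to the nearest integer, `min_{k ∈ ℤ} |x - k|`. -/
noncomputable def distZ (x : ℝ) : ℝ := |x - (round x : ℝ)|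

open Filter Topology

theorem hasSum_one_div_succ_sq :
    HasSum (fun n : ℕ => 1 / ((n : ℝ) + 1) ^ 2) (Real.pi ^ 2 / 6) := by
  have h := (hasSum_nat_add_iff' (f := fun n : ℕ => 1 / (n : ℝ) ^ 2) 1).mpr hasSum_zeta_two
  simpa using h

theorem abs_sin_div_succ_sq_le (n : ℕ) :
    |Real.sin (((n : ℝ) + 1) * Real.pi / 3) / ((n : ℝ) + 1) ^ 2| ≤ 1 / ((n : ℝ) + 1) ^ 2 := by
  rw [abs_div, abs_of_pos (show (0 : ℝ) < ((n : ℝ) + 1) ^ 2 by positivity)]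
  gcongr
  exact Real.abs_sin_le_one _

theorem hasSum_G :
    HasSum (fun n : ℕ => Real.sin (((n : ℝ) + 1) * Real.pi / 3) / ((n : ℝ) + 1) ^ 2) G :=
  (Summable.of_norm_bounded hasSum_one_div_succ_sq.summable abs_sin_div_succ_sq_le).hasSum

theorem sum_range_six_sin_div_succ_sq :
    ∑ n ∈ Finset.range 6, Real.sin (((n : ℝ) + 1) * Real.pi / 3) / ((n : ℝ) + 1) ^ 2 =
      √3 / 2 * (459 / 400) := by
  have h1 : Real.sin (Real.pi / 3) = √3 / 2 := Real.sin_pi_div_three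
  have h2 : Real.sin (2 * Real.pi / 3) = √3 / 2 := by
    rw [← h1, ← Real.sin_pi_sub]; ring_nf
  have h3 : Real.sin (3 * Real.pi / 3) = 0 := by
    rw [← Real.sin_pi]; ring_nf
  have h4 : Real.sin (4 * Real.pi / 3) = -(√3 / 2) := by
    rw [← h1, ← Real.sin_add_pi]; ring_nf
  have h5 : Real.sin (5 * Real.pi / 3) = -(√3 / 2) := by
    rw [← h2, ← Real.sin_add_pi]; ring_nf
  have h6 : Real.sin (6 * Real.pi / 3) = 0 := by
    rw [← Real.sin_two_pi]; ring_nf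
  simp only [Finset.sum_range_succ, Finset.sum_range_zero]
  norm_num [h1, h2, h3, h4, h5, h6]
  ring

theorem abs_G_sub_le : |G - √3 / 2 * (459 / 400)| ≤ Real.pi ^ 2 / 6 - 5369 / 3600 := by
  have hQ : ∑ n ∈ Finset.range 6, 1 / ((n : ℝ) + 1) ^ 2 = 5369 / 3600 := by
    norm_num [Finset.sum_range_succ]
  have hadd := sum_le_hasSum (Finset.range 6)
    (fun n _ => by linarith [(abs_le.mp (abs_sin_div_succ_sq_le n)).1])
    (hasSum_one_div_succ_sq.add hasSum_G)
  have hsub := sum_le_hasSum (Finset.range 6)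
    (fun n _ => sub_nonneg.mpr (abs_le.mp (abs_sin_div_succ_sq_le n)).2)
    (hasSum_one_div_succ_sq.sub hasSum_G)
  rw [Finset.sum_add_distrib, hQ, sum_range_six_sin_div_succ_sq] at hadd
  rw [Finset.sum_sub_distrib, hQ, sum_range_six_sin_div_succ_sq] at hsub
  rw [abs_le]
  constructor <;> linarith

theorem alpha_mem_Ioo : alpha ∈ Set.Ioo (32 : ℝ) 48 := by
  obtain ⟨hl, hu⟩ := abs_le.mp abs_G_sub_le
  have hs1 : (1.732 : ℝ) < √3 := Real.lt_sqrt_of_sq_lt (by norm_num)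
  have hs2 : √3 < (1.733 : ℝ) := (Real.sqrt_lt' (by norm_num)).mpr (by norm_num)
  have hp1 : (3.14 : ℝ) ^ 2 < Real.pi ^ 2 := by gcongr; exact Real.pi_gt_d2
  have hp2 : Real.pi ^ 2 < (3.15 : ℝ) ^ 2 := by gcongr; exact Real.pi_lt_d2
  have hG : 0 < G := by linarith
  rw [alpha, Set.mem_Ioo, lt_div_iff₀ hG, div_lt_iff₀ hG]
  constructor <;> linarith

/-- If `a (m + 3/4)²` tends to `0` modulo `1`, then `a` is a multiple of `16`. -/
theorem exists_eq_sixteen_mul_of_tendsto {a : ℝ}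
    (h : Tendsto (fun m : ℕ => ((a * ((m : ℝ) + 3 / 4) ^ 2 : ℝ) : UnitAddCircle))
      atTop (𝓝 0)) : ∃ l : ℤ, a = 16 * l := by
  have of_const {u : ℕ → UnitAddCircle} {x : ℝ} (hu : Tendsto u atTop (𝓝 0))
      (hx : ∀ m, ∃ n : ℤ, u m = ((x + n : ℝ) : UnitAddCircle)) : ∃ k : ℤ, (k : ℝ) = x := by
    have hux : u = fun _ => (x : UnitAddCircle) := by
      funext m
      obtain ⟨n, hn⟩ := hx m
      rw [hn, AddCircle.coe_add, (AddCircle.coe_eq_zero_iff (x := (n : ℝ)) 1).mpr ⟨n, by simp⟩,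
        add_zero]
    rw [hux] at hu
    obtain ⟨k, hk⟩ := (AddCircle.coe_eq_zero_iff (1 : ℝ)).mp
      (tendsto_nhds_unique tendsto_const_nhds hu)
    exact ⟨k, by simpa using hk⟩
  have h1 := (h.comp (tendsto_add_atTop_nat 1)).sub h
  have h2 := (h1.comp (tendsto_add_atTop_nat 1)).sub h1
  simp only [Function.comp_def, sub_zero, ← AddCircle.coe_sub] at h1 h2
  obtain ⟨k, hk⟩ := of_const (x := 2 * a) h2 fun m => ⟨0, by
    congr 1; push_cast; ring⟩
  obtain ⟨p, hp⟩ := of_const (x := 5 * k / 4) h1 fun m => ⟨k * m, by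
    congr 1; push_cast; rw [hk]; ring⟩
  have hp' : 4 * p = 5 * k := by
    have : (4 * p : ℝ) = 5 * k := by rw [hp]; ring
    exact_mod_cast this
  obtain ⟨j, rfl⟩ : (4 : ℤ) ∣ k := by omega
  have ha : a = 2 * j := by push_cast at hk; linarith
  obtain ⟨q, hq⟩ := of_const (x := 9 * j / 8) h fun m => ⟨2 * j * m ^ 2 + 3 * j * m, by
    congr 1; push_cast; rw [ha]; ring⟩
  have hq' : 8 * q = 9 * j := by
    have : (8 * q : ℝ) = 9 * j := by rw [hq]; ring
    exact_mod_cast this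
  obtain ⟨l, rfl⟩ : (8 : ℤ) ∣ j := by omega
  exact ⟨l, by rw [ha]; push_cast; ring⟩

theorem good_plus_subsequence :
    ∃ δ : ℝ, 0 < δ ∧ ∃ M : Set ℕ, M.Infinite ∧
      ∀ m ∈ M, δ ≤ distZ (alpha * ((m : ℝ) + 3 / 4) ^ 2) := by
  by_contra! hcon
  have h : Tendsto (fun m : ℕ => ((alpha * ((m : ℝ) + 3 / 4) ^ 2 : ℝ) : UnitAddCircle))
      atTop (𝓝 0) := by
    rw [NormedAddGroup.tendsto_nhds_zero]
    intro ε hε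
    have hfin : {m : ℕ | ε ≤ distZ (alpha * ((m : ℝ) + 3 / 4) ^ 2)}.Finite := by
      by_contra hinf
      obtain ⟨m, hm, hlt⟩ := hcon ε hε _ hinf
      exact absurd hm (not_le.mpr hlt)
    have hev := hfin.compl_mem_cofinite
    rw [Nat.cofinite_eq_atTop] at hev
    filter_upwards [hev] with m hm
    rw [UnitAddCircle.norm_eq]
    exact not_le.mp hm
  obtain ⟨l, hl⟩ := exists_eq_sixteen_mul_of_tendsto h
  obtain ⟨h1, h2⟩ := alpha_mem_Ioo
  rw [hl] at h1 h2
  have h3 : (32 : ℤ) < 16 * l := by exact_mod_cast h1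
  have h4 : 16 * l < (48 : ℤ) := by exact_mod_cast h2
  omega
end

section
/- For every δ > 0 there exist constants u₁, u₂, u₃ > 0 and M₀ ∈ ℕ such that for every natural number m ≥ M₀ with dist(α(m+1/4)², ℤ) ≥ δ, setting r_m := π(m+1/4) and N_m := 2⌊α(m+1/4)²/2⌋, one has u₁·N_m^{−1/2} ≤ r_m − c√N_m ≤ u₂·N_m^{−1/2}, u₁·N_m^{−1/2} ≤ c√(N_m+2) − r_m ≤ u₂·N_m^{−1/2}, and |c√(N_m + j) − r_m| ≤ u₃·N_m^{−1/2} for each j ∈ {−1, 1, 3}. -/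
noncomputable def cconst : ℝ := Real.sqrt (G / 4)

theorem summable_sin_div_sq :
    Summable fun n : ℕ => Real.sin (((n : ℝ) + 1) * Real.pi / 3) / ((n : ℝ) + 1) ^ 2 := by
  have h : Summable fun n : ℕ => 1 / ((n : ℝ) + 1) ^ 2 := by
    have := (summable_nat_add_iff 1).2 (Real.summable_one_div_nat_pow.2 (one_lt_two))
    simpa using this
  refine Summable.of_norm_bounded h fun n => ?_
  rw [norm_div, Real.norm_eq_abs, Real.norm_eq_abs,
    abs_of_nonneg (by positivity : (0 : ℝ) ≤ ((n : ℝ) + 1) ^ 2)]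
  gcongr
  exact Real.abs_sin_le_one _

theorem sin_div_sq_block_pos (k : ℕ) :
    0 < ∑ i ∈ Finset.range 6, Real.sin ((((6 * k + i : ℕ) : ℝ) + 1) * Real.pi / 3) /
      (((6 * k + i : ℕ) : ℝ) + 1) ^ 2 := by
  have key (i : ℕ) : Real.sin ((((6 * k + i : ℕ) : ℝ) + 1) * Real.pi / 3) =
      Real.sin (((i : ℝ) + 1) * Real.pi / 3) := by
    rw [← Real.sin_add_nat_mul_two_pi (((i : ℝ) + 1) * Real.pi / 3) k]
    congr 1
    push_cast
    ring
  have s1 : Real.sin (((0 : ℕ) + 1 : ℝ) * Real.pi / 3) = √3 / 2 := by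
    rw [← Real.sin_pi_div_three]; congr 1; push_cast; ring
  have s2 : Real.sin (((1 : ℕ) + 1 : ℝ) * Real.pi / 3) = √3 / 2 := by
    rw [← Real.sin_pi_div_three, ← Real.sin_pi_sub]; congr 1; push_cast; ring
  have s3 : Real.sin (((2 : ℕ) + 1 : ℝ) * Real.pi / 3) = 0 := by
    rw [← Real.sin_pi]; congr 1; push_cast; ring
  have s4 : Real.sin (((3 : ℕ) + 1 : ℝ) * Real.pi / 3) = -(√3 / 2) := by
    rw [← Real.sin_pi_div_three, ← Real.sin_add_pi]; congr 1; push_cast; ring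
  have s5 : Real.sin (((4 : ℕ) + 1 : ℝ) * Real.pi / 3) = -(√3 / 2) := by
    rw [← Real.sin_pi_div_three, ← Real.sin_neg, ← Real.sin_sub_two_pi]
    congr 1; push_cast; ring
  have s6 : Real.sin (((5 : ℕ) + 1 : ℝ) * Real.pi / 3) = 0 := by
    rw [← Real.sin_two_pi]; congr 1; push_cast; ring
  simp only [Finset.sum_range_succ, Finset.sum_range_zero, key, s1, s2, s3, s4, s5, s6]
  have h3 : (0 : ℝ) < √3 / 2 := by positivity
  have h14 : √3 / 2 / (((6 * k + 3 : ℕ) : ℝ) + 1) ^ 2 <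
      √3 / 2 / (((6 * k + 0 : ℕ) : ℝ) + 1) ^ 2 := by
    gcongr; norm_num
  have h25 : √3 / 2 / (((6 * k + 4 : ℕ) : ℝ) + 1) ^ 2 <
      √3 / 2 / (((6 * k + 1 : ℕ) : ℝ) + 1) ^ 2 := by
    gcongr; norm_num
  simp only [neg_div, zero_div]
  linarith

theorem G_pos : 0 < G := by
  set f : ℕ → ℝ := fun n => Real.sin (((n : ℝ) + 1) * Real.pi / 3) / ((n : ℝ) + 1) ^ 2
  have hlim : Filter.Tendsto (fun k : ℕ => ∑ i ∈ Finset.range (6 * k), f i)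
      Filter.atTop (nhds G) :=
    summable_sin_div_sq.hasSum.tendsto_sum_nat.comp
      (Filter.tendsto_id.const_mul_atTop' (by norm_num))
  have hmono : StrictMono fun k : ℕ => ∑ i ∈ Finset.range (6 * k), f i := by
    refine strictMono_nat_of_lt_succ fun k => ?_
    rw [mul_add, mul_one, Finset.sum_range_add]
    exact lt_add_of_pos_right _ (sin_div_sq_block_pos k)
  calc (0 : ℝ) = ∑ i ∈ Finset.range (6 * 0), f i := by simp
    _ < ∑ i ∈ Finset.range (6 * 1), f i := hmono one_pos
    _ ≤ G := hmono.monotone.ge_of_tendsto hlim 1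

theorem alpha_pos : 0 < alpha := by
  have := G_pos
  unfold alpha
  positivity

theorem cconst_pos : 0 < cconst := Real.sqrt_pos.2 (by linarith [G_pos])

theorem cconst_mul_sqrt_alpha_mul_sq {x : ℝ} (hx : 0 ≤ x) :
    cconst * √(alpha * x ^ 2) = Real.pi * x := by
  have hG := G_pos
  rw [cconst, ← Real.sqrt_mul (by positivity), alpha,
    show G / 4 * (4 * Real.pi ^ 2 / G * x ^ 2) = (Real.pi * x) ^ 2 by field_simp]
  exact Real.sqrt_sq (by positivity)

theorem distZ_le_abs_sub (x : ℝ) (z : ℤ) : distZ x ≤ |x - z| := round_le x z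

theorem abs_sqrt_sub_sqrt_le {a b n d : ℝ} (hn : 0 < n) (ha : 0 ≤ a) (hb : n ≤ b)
    (hd : |a - b| ≤ d) : |√a - √b| ≤ d / √n := by
  have hn' : 0 < √n := Real.sqrt_pos.2 hn
  have hb' : √n ≤ √b := Real.sqrt_le_sqrt hb
  have hsum : √n ≤ √a + √b := by linarith [Real.sqrt_nonneg a]
  have hfac : a - b = (√a - √b) * (√a + √b) := by
    nlinarith [Real.sq_sqrt ha, Real.sq_sqrt (hn.le.trans hb)]
  rw [le_div_iff₀ hn']
  calc |√a - √b| * √n ≤ |√a - √b| * (√a + √b) := by gcongr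
    _ = |a - b| := by rw [hfac, abs_mul, abs_of_pos (hn'.trans_le hsum)]
    _ ≤ d := hd

theorem div_le_sqrt_sub_sqrt {a b n d : ℝ} (hn : 0 < n) (ha : 0 ≤ a) (hd0 : 0 ≤ d)
    (hd : d ≤ b - a) (hb : b ≤ 4 * n) : d / 4 / √n ≤ √b - √a := by
  have hn' : 0 < √n := Real.sqrt_pos.2 hn
  have hb' : √b ≤ 2 * √n := by
    refine Real.sqrt_le_iff.2 ⟨by positivity, ?_⟩
    rw [mul_pow, Real.sq_sqrt hn.le]
    linarith
  have hab : √a ≤ √b := Real.sqrt_le_sqrt (by linarith)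
  rw [div_le_iff₀ hn']
  nlinarith [Real.sq_sqrt ha, Real.sq_sqrt (show 0 ≤ b by linarith)]

theorem minus_distances (δ : ℝ) (hδ : 0 < δ) :
    ∃ u₁ u₂ u₃ : ℝ, 0 < u₁ ∧ 0 < u₂ ∧ 0 < u₃ ∧ ∃ M₀ : ℕ,
      ∀ m : ℕ, M₀ ≤ m →
        δ ≤ distZ (alpha * ((m : ℝ) + 1 / 4) ^ 2) →
        let r : ℝ := Real.pi * ((m : ℝ) + 1 / 4)
        let N : ℤ := 2 * ⌊alpha * ((m : ℝ) + 1 / 4) ^ 2 / 2⌋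
        (u₁ * (N : ℝ) ^ (-(1 / 2 : ℝ)) ≤ r - cconst * Real.sqrt (N : ℝ) ∧
          r - cconst * Real.sqrt (N : ℝ) ≤ u₂ * (N : ℝ) ^ (-(1 / 2 : ℝ))) ∧
        (u₁ * (N : ℝ) ^ (-(1 / 2 : ℝ)) ≤ cconst * Real.sqrt ((N : ℝ) + 2) - r ∧
          cconst * Real.sqrt ((N : ℝ) + 2) - r ≤ u₂ * (N : ℝ) ^ (-(1 / 2 : ℝ))) ∧
        ∀ j : ℤ, j = -1 ∨ j = 1 ∨ j = 3 →
          |cconst * Real.sqrt ((N : ℝ) + (j : ℝ)) - r| ≤ u₃ * (N : ℝ) ^ (-(1 / 2 : ℝ)) := by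
  have hc := cconst_pos
  have hα := alpha_pos
  refine ⟨cconst * (δ / 4), cconst * 2, cconst * 3, by positivity, by positivity, by positivity,
    max 1 ⌈4 / alpha⌉₊, fun m hm hdist => ?_⟩
  intro r N
  have hr : r = cconst * √(alpha * ((m : ℝ) + 1 / 4) ^ 2) :=
    (cconst_mul_sqrt_alpha_mul_sq (by positivity)).symm
  set X : ℝ := alpha * ((m : ℝ) + 1 / 4) ^ 2 with hX
  have hX4 : 4 ≤ X := by
    have h1 : (1 : ℝ) ≤ m := by exact_mod_cast (le_max_left _ _).trans hm
    have h2 : 4 / alpha ≤ (m : ℝ) := Nat.ceil_le.1 ((le_max_right _ _).trans hm)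
    rw [div_le_iff₀ hα] at h2
    nlinarith
  have hN : (N : ℝ) = 2 * (⌊X / 2⌋ : ℝ) := by simp only [N, Int.cast_mul, Int.cast_ofNat, hX]
  have hNX : (N : ℝ) ≤ X := by linarith [Int.floor_le (X / 2)]
  have hXN : X < N + 2 := by linarith [Int.lt_floor_add_one (X / 2)]
  have hlow : δ ≤ X - N := by
    have := hdist.trans (distZ_le_abs_sub X N)
    rwa [abs_of_nonneg (by linarith)] at this
  have hupp : δ ≤ N + 2 - X := by
    have := hdist.trans (distZ_le_abs_sub X (N + 2))
    push_cast at this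
    rwa [abs_of_neg (by linarith), neg_sub] at this
  have hN0 : (0 : ℝ) < N := by linarith
  have hpow : (N : ℝ) ^ (-(1 / 2 : ℝ)) = 1 / √(N : ℝ) := by
    rw [Real.rpow_neg hN0.le, ← Real.sqrt_eq_rpow, one_div]
  have hscale (t : ℝ) : cconst * t * (1 / √(N : ℝ)) = cconst * (t / √(N : ℝ)) := by ring
  have hle {a d : ℝ} (ha : 0 ≤ a) (hd : |a - X| ≤ d) :
      |cconst * √a - r| ≤ cconst * (d / √(N : ℝ)) := by
    rw [hr, ← mul_sub, abs_mul, abs_of_pos hc]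
    gcongr
    exact abs_sqrt_sub_sqrt_le hN0 ha hNX hd
  simp only [hpow, hscale]
  refine ⟨⟨?_, ?_⟩, ⟨?_, ?_⟩, fun j hj => ?_⟩
  · rw [hr, ← mul_sub]
    gcongr
    exact div_le_sqrt_sub_sqrt hN0 hN0.le hδ.le hlow (by linarith)
  · refine (le_abs_self _).trans ?_
    rw [abs_sub_comm]
    exact hle hN0.le (by rw [abs_le]; constructor <;> linarith)
  · rw [hr, ← mul_sub]
    gcongr
    exact div_le_sqrt_sub_sqrt hN0 (by linarith) hδ.le hupp (by linarith)
  · exact (le_abs_self _).trans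
      (hle (by linarith) (by rw [abs_le]; constructor <;> linarith))
  · rcases hj with rfl | rfl | rfl <;> push_cast <;>
      exact hle (by linarith) (by rw [abs_le]; constructor <;> linarith)
end
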